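/- (Moser iteration boundary estimate.) Let Ω ⊂ ℝ^n be bounded smooth, Γ a connected component of ∂Ω, u ∈ W^{1,n}(Ω) n-harmonic in Ω with u = 0 on Γ (extended by 0 on the other side of Γ). Then there are constants C = C(Ω,n) > 0 and q = q(Ω,n) > 1 such that for every x ∈ Γ and 0 < r < R with B_R(x) ∩ ∂Ω ⊂ Γ, ‖u_+‖_{L^∞(B_r(x)∩Ω)} ≤ C (R−r)^{−q} ‖u_+‖_{L^n(B_R(x)∩Ω)}. -/

import Mathlib

open MeasureTheory Metric Set Filter
open scoped RealInnerProductSpace ENNReal Topology NNReal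

noncomputable section

abbrev E (n : ℕ) := EuclideanSpace ℝ (Fin n)

/-- The derivative of `Real.smoothTransition` is bounded. -/
theorem exists_bound_deriv_smoothTransition :
    ∃ M : ℝ, 0 < M ∧ (∀ s, |deriv Real.smoothTransition s| ≤ M) ∧
      ∀ s < 0, deriv Real.smoothTransition s = 0 := by
  have hc : Continuous (deriv Real.smoothTransition) :=
    (Real.smoothTransition.contDiff (n := 1)).continuous_deriv (by norm_num)
  have hneg : ∀ s < 0, deriv Real.smoothTransition s = 0 := fun s hs => by
    have : Real.smoothTransition =ᶠ[𝓝 s] fun _ => 0 := by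
      filter_upwards [Iio_mem_nhds hs] with y hy
      exact Real.smoothTransition.zero_of_nonpos (le_of_lt hy)
    rw [this.deriv_eq, deriv_const]
  have hpos : ∀ s, 1 < s → deriv Real.smoothTransition s = 0 := fun s hs => by
    have : Real.smoothTransition =ᶠ[𝓝 s] fun _ => 1 := by
      filter_upwards [Ioi_mem_nhds hs] with y hy
      exact Real.smoothTransition.one_of_one_le (le_of_lt hy)
    rw [this.deriv_eq, deriv_const]
  obtain ⟨M, hM⟩ := (isCompact_Icc (a := (0 : ℝ)) (b := 1)).exists_bound_of_continuousOn
    hc.continuousOn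
  refine ⟨max M 1, by positivity, fun s => ?_, hneg⟩
  by_cases h0 : s < 0
  · rw [hneg s h0, abs_zero]; positivity
  by_cases h1 : 1 < s
  · rw [hpos s h1, abs_zero]; positivity
  · exact (hM s ⟨not_lt.1 h0, not_lt.1 h1⟩).trans (le_max_left _ _)

/-- Cutoff functions between concentric balls, with the expected bound on the derivative. -/
theorem exists_cutoff (F : Type*) [NormedAddCommGroup F] [InnerProductSpace ℝ F] :
    ∃ M : ℝ, 0 < M ∧ ∀ (x : F) (t T : ℝ), 0 < t → t < T → ∃ ξ : F → ℝ,
      ContDiff ℝ 1 ξ ∧ (∀ y, 0 ≤ ξ y) ∧ (∀ y, ξ y ≤ 1) ∧ (∀ y ∈ ball x t, ξ y = 1) ∧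
      (∀ y ∉ ball x T, ξ y = 0) ∧ ∀ y, ‖fderiv ℝ ξ y‖ ≤ M / (T - t) := by
  obtain ⟨M, hM, hb, hneg⟩ := exists_bound_deriv_smoothTransition
  refine ⟨2 * M, by positivity, fun x t T ht htT => ?_⟩
  have hd : 0 < T ^ 2 - t ^ 2 := by nlinarith
  refine ⟨fun y => Real.smoothTransition ((T ^ 2 - ‖y - x‖ ^ 2) / (T ^ 2 - t ^ 2)), ?_,
    fun y => Real.smoothTransition.nonneg _, fun y => Real.smoothTransition.le_one _, ?_, ?_, ?_⟩
  · refine (Real.smoothTransition.contDiff (n := 1)).comp ?_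
    exact (contDiff_const.sub ((contDiff_id.sub contDiff_const).norm_sq ℝ)).div_const _
  · intro y hy
    rw [mem_ball, dist_eq_norm] at hy
    refine Real.smoothTransition.one_of_one_le ?_
    rw [le_div_iff₀ hd]
    nlinarith [norm_nonneg (y - x)]
  · intro y hy
    rw [mem_ball, dist_eq_norm, not_lt] at hy
    refine Real.smoothTransition.zero_of_nonpos (div_nonpos_of_nonpos_of_nonneg ?_ hd.le)
    nlinarith [norm_nonneg (y - x)]
  · intro y
    have h1 : HasFDerivAt (fun y => (T ^ 2 - ‖y - x‖ ^ 2) / (T ^ 2 - t ^ 2))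
        ((T ^ 2 - t ^ 2)⁻¹ • -(2 • innerSL ℝ (y - x)) : F →L[ℝ] ℝ) y := by
      have := (((hasFDerivAt_id y).sub_const x).norm_sq).const_sub (T ^ 2)
      simpa [div_eq_inv_mul] using this.const_mul ((T ^ 2 - t ^ 2)⁻¹)
    have h2 := (((Real.smoothTransition.contDiff (n := 1)).differentiable
      (by norm_num)) _).hasDerivAt.comp_hasFDerivAt y h1
    erw [h2.fderiv]
    rw [norm_smul, norm_smul, norm_neg, Real.norm_eq_abs]
    rcases le_or_gt ‖y - x‖ T with hy | hy
    · have h3 : ‖2 • innerSL ℝ (y - x)‖ ≤ 2 * T := by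
        rw [two_nsmul, two_mul]
        refine (norm_add_le _ _).trans ?_
        rw [innerSL_apply_norm]
        linarith
      calc _ ≤ M * (‖(T ^ 2 - t ^ 2)⁻¹‖ * (2 * T)) := by gcongr; exact hb _
        _ = 2 * M * T / ((T - t) * (T + t)) := by
          rw [norm_inv, Real.norm_of_nonneg hd.le, show T ^ 2 - t ^ 2 = (T - t) * (T + t) by ring]
          ring
        _ ≤ 2 * M / (T - t) := by
          have : 0 < T - t := by linarith
          rw [div_le_div_iff₀ (by nlinarith) this]
          have : 0 ≤ M * (T - t) * t := by positivity
          nlinarith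
    · rw [hneg _ (div_neg_of_neg_of_pos (by nlinarith) hd), abs_zero, zero_mul]
      have : 0 < T - t := by linarith
      positivity

/-- A function that is `C¹` on an open set and vanishes there off a closed subset extends by zero
to a `C¹` function. -/
theorem contDiff_indicator_of_eqOn_zero {F : Type*} [NormedAddCommGroup F] [NormedSpace ℝ F]
    {Ω K : Set F} {f : F → ℝ} (hΩ : IsOpen Ω) (hK : IsClosed K) (hKΩ : K ⊆ Ω)
    (hf : ContDiffOn ℝ 1 f Ω) (h0 : ∀ y ∈ Ω, y ∉ K → f y = 0) :
    ContDiff ℝ 1 (Ω.indicator f) := by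
  rw [contDiff_iff_contDiffAt]
  intro y
  by_cases hy : y ∈ K
  · have hmem := hΩ.mem_nhds (hKΩ hy)
    refine (hf.contDiffAt hmem).congr_of_eventuallyEq ?_
    filter_upwards [hmem] with z hz
    exact indicator_of_mem hz f
  · refine (contDiffAt_const (c := (0 : ℝ))).congr_of_eventuallyEq ?_
    filter_upwards [hK.isOpen_compl.mem_nhds hy] with z hz
    by_cases hzΩ : z ∈ Ω
    · rw [indicator_of_mem hzΩ, h0 z hzΩ hz]
    · exact indicator_of_notMem hzΩ f

/-- A function that is continuous on a measurable set and vanishes there off a compact subset is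
integrable. -/
theorem integrableOn_of_continuousOn_of_eqOn_zero {F : Type*} [NormedAddCommGroup F]
    [MeasurableSpace F] [BorelSpace F] {μ : Measure F} [IsFiniteMeasureOnCompacts μ]
    {Ω K : Set F} {f : F → ℝ} (hΩ : MeasurableSet Ω) (hK : IsCompact K) (hKΩ : K ⊆ Ω)
    (hf : ContinuousOn f Ω) (h0 : ∀ y ∈ Ω, y ∉ K → f y = 0) : IntegrableOn f Ω μ :=
  ((hf.mono hKΩ).integrableOn_compact hK).of_forall_sdiff_eq_zero hΩ fun y hy => h0 y hy.1 hy.2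

/-- Convex increasing `C¹` functions `w` on the line, with derivative `p`, vanishing on
`(-∞, ε]`. -/
structure IsTruncation (ε : ℝ) (w p : ℝ → ℝ) : Prop where
  hasDerivAt : ∀ s, HasDerivAt w (p s) s
  continuous_deriv : Continuous p
  monotone_deriv : Monotone p
  deriv_eq_zero : ∀ s ≤ ε, p s = 0
  eq_zero : ∀ s ≤ ε, w s = 0

namespace IsTruncation

variable {ε : ℝ} {w p : ℝ → ℝ}

theorem deriv_nonneg (h : IsTruncation ε w p) (s : ℝ) : 0 ≤ p s := by
  rcases le_total s ε with hs | hs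
  · rw [h.deriv_eq_zero s hs]
  · rw [← h.deriv_eq_zero ε le_rfl]; exact h.monotone_deriv hs

theorem monotone (h : IsTruncation ε w p) : Monotone w :=
  monotone_of_hasDerivAt_nonneg (fun s => h.hasDerivAt s) h.deriv_nonneg

theorem nonneg (h : IsTruncation ε w p) (s : ℝ) : 0 ≤ w s := by
  rcases le_total s ε with hs | hs
  · rw [h.eq_zero s hs]
  · rw [← h.eq_zero ε le_rfl]; exact h.monotone hs

theorem contDiff (h : IsTruncation ε w p) : ContDiff ℝ 1 w := by
  rw [contDiff_one_iff_deriv]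
  refine ⟨fun s => (h.hasDerivAt s).differentiableAt, ?_⟩
  rw [show deriv w = p from funext fun s => (h.hasDerivAt s).deriv]
  exact h.continuous_deriv

/-- Positive powers of truncations are truncations. -/
theorem pow (h : IsTruncation ε w p) {a : ℕ} (ha : a ≠ 0) :
    IsTruncation ε (fun s => w s ^ a) (fun s => a * w s ^ (a - 1) * p s) where
  hasDerivAt s := (h.hasDerivAt s).pow a
  continuous_deriv :=
    (continuous_const.mul (h.contDiff.continuous.pow _)).mul h.continuous_deriv
  monotone_deriv s t hst := by
    have := h.monotone hst
    have := h.monotone_deriv hst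
    have := h.nonneg s
    have := h.nonneg t
    have := h.deriv_nonneg s
    beta_reduce
    gcongr
  deriv_eq_zero s hs := by rw [h.deriv_eq_zero s hs, mul_zero]
  eq_zero s hs := by rw [h.eq_zero s hs, zero_pow ha]

/-- The primitive of `pⁿ` is dominated by `pⁿ⁻¹ w`. -/
theorem exists_primitive (h : IsTruncation ε w p) {n : ℕ} (hn : n ≠ 0) :
    ∃ G : ℝ → ℝ, IsTruncation ε G (fun s => p s ^ n) ∧ ∀ s, G s ≤ p s ^ (n - 1) * w s := by
  have hc : Continuous fun s => p s ^ n := h.continuous_deriv.pow n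
  have hG0 : ∀ s ≤ ε, (∫ τ in ε..s, p τ ^ n) = 0 := fun s hs => by
    rw [intervalIntegral.integral_symm, intervalIntegral.integral_congr (g := fun _ => 0)]
    · simp
    · intro τ hτ
      rw [uIcc_of_le hs] at hτ
      simp [h.deriv_eq_zero τ hτ.2, hn]
  refine ⟨fun s => ∫ τ in ε..s, p τ ^ n, ⟨fun s => (hc.integral_hasStrictDerivAt ε s).hasDerivAt,
    hc, fun s t hst => ?_, fun s hs => ?_, hG0⟩, fun s => ?_⟩
  · exact pow_le_pow_left₀ (h.deriv_nonneg s) (h.monotone_deriv hst) n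
  · simp [h.deriv_eq_zero s hs, hn]
  · rcases le_total s ε with hs | hs
    · beta_reduce
      rw [hG0 s hs, h.eq_zero s hs, mul_zero]
    · have hw : w s = ∫ τ in ε..s, p τ := by
        rw [intervalIntegral.integral_eq_sub_of_hasDerivAt (fun τ _ => h.hasDerivAt τ)
          (h.continuous_deriv.intervalIntegrable _ _), h.eq_zero ε le_rfl, sub_zero]
      rw [hw, ← intervalIntegral.integral_const_mul]
      refine intervalIntegral.integral_mono_on hs (hc.intervalIntegrable _ _)
        ((continuous_const.mul h.continuous_deriv).intervalIntegrable _ _) fun τ hτ => ?_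
      obtain ⟨m, rfl⟩ := Nat.exists_eq_succ_of_ne_zero hn
      rw [pow_succ, Nat.succ_sub_one]
      have := h.monotone_deriv hτ.2
      have := h.deriv_nonneg τ
      gcongr

end IsTruncation

/-- Truncations approximating the positive part from below. -/
theorem exists_isTruncation {ε : ℝ} (hε : 0 < ε) :
    ∃ w p : ℝ → ℝ, IsTruncation ε w p ∧ (∀ s, w s ≤ max s 0) ∧ ∀ s, s - 2 * ε ≤ w s := by
  set p : ℝ → ℝ := fun s => max (min ((s - ε) / ε) 1) 0 with hp
  have hc : Continuous p := by fun_prop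
  have hp0 : ∀ s ≤ ε, p s = 0 := fun s hs => by
    have : (s - ε) / ε ≤ 0 := div_nonpos_of_nonpos_of_nonneg (by linarith) hε.le
    exact max_eq_right ((min_le_left _ _).trans this)
  have hp1 : ∀ s, p s ≤ 1 := fun s => max_le (min_le_right _ _) zero_le_one
  have hpn : ∀ s, 0 ≤ p s := fun s => le_max_right _ _
  have hp2 : ∀ s, 2 * ε ≤ s → p s = 1 := fun s hs => by
    refine le_antisymm (hp1 s) (le_max_of_le_left (le_min ?_ le_rfl))
    rw [le_div_iff₀ hε]; linarith
  have hder : ∀ s, HasDerivAt (fun s => ∫ τ in ε..s, p τ) (p s) s := fun s =>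
    (hc.integral_hasStrictDerivAt ε s).hasDerivAt
  have hT : IsTruncation ε (fun s => ∫ τ in ε..s, p τ) p := by
    refine ⟨hder, hc, fun s t hst => ?_, hp0, fun s hs => ?_⟩
    · simp only [hp]; gcongr
    · rw [intervalIntegral.integral_symm, intervalIntegral.integral_congr (g := fun _ => 0)]
      · simp
      · intro τ hτ
        rw [uIcc_of_le hs] at hτ
        exact hp0 τ hτ.2
  refine ⟨_, p, hT, fun s => ?_, fun s => ?_⟩
  · rcases le_total s ε with hs | hs
    · rw [hT.eq_zero s hs]; exact le_max_right _ _
    · have := intervalIntegral.integral_mono_on hs (hc.intervalIntegrable (μ := volume) _ _)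
        (continuous_const.intervalIntegrable _ _) fun τ _ => hp1 τ
      simp at this
      exact le_max_of_le_left (by linarith)
  · rcases le_total s (2 * ε) with hs | hs
    · have := hT.nonneg s
      linarith
    · have h1 := intervalIntegral.integral_add_adjacent_intervals
        (hc.intervalIntegrable (μ := volume) ε (2 * ε)) (hc.intervalIntegrable (2 * ε) s)
      have h2 : ∫ τ in (2 * ε)..s, p τ = s - 2 * ε := by
        rw [intervalIntegral.integral_congr (g := fun _ => 1)]
        · simp
        · intro τ hτ
          rw [uIcc_of_le hs] at hτ
          exact hp2 τ hτ.1
      have := hT.nonneg (2 * ε)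
      linarith

theorem eLpNorm_natCast_eq_ofReal_integral_pow {α : Type*} [MeasurableSpace α] {μ : Measure α}
    {n : ℕ} (hn : n ≠ 0) {f : α → ℝ} (hf : ∀ᵐ y ∂μ, 0 ≤ f y)
    (hfi : Integrable (fun y => f y ^ n) μ) :
    eLpNorm f n μ = ENNReal.ofReal (∫ y, f y ^ n ∂μ) ^ (1 / (n : ℝ)) := by
  rw [eLpNorm_eq_lintegral_rpow_enorm_toReal (by exact_mod_cast hn) (by simp),
    ofReal_integral_eq_lintegral_ofReal hfi (hf.mono fun y hy => pow_nonneg hy n)]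
  simp only [ENNReal.toReal_natCast]
  congr 1
  refine lintegral_congr_ae (hf.mono fun y hy => ?_)
  beta_reduce
  rw [ENNReal.rpow_natCast, Real.enorm_eq_ofReal hy, ENNReal.ofReal_pow hy]

theorem eLpNorm_le_mul_eLpNorm_of_integral_pow_le {α : Type*} [MeasurableSpace α] {μ : Measure α}
    {n : ℕ} (hn : n ≠ 0) {f g : α → ℝ} (hf : ∀ᵐ y ∂μ, 0 ≤ f y) (hg : ∀ᵐ y ∂μ, 0 ≤ g y)
    (hfi : Integrable (fun y => f y ^ n) μ) (hgi : Integrable (fun y => g y ^ n) μ)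
    {c : ℝ} (hc : 0 ≤ c) (h : ∫ y, f y ^ n ∂μ ≤ c ^ n * ∫ y, g y ^ n ∂μ) :
    eLpNorm f n μ ≤ ENNReal.ofReal c * eLpNorm g n μ := by
  rw [eLpNorm_natCast_eq_ofReal_integral_pow hn hf hfi,
    eLpNorm_natCast_eq_ofReal_integral_pow hn hg hgi]
  calc _ ≤ ENNReal.ofReal (c ^ n * ∫ y, g y ^ n ∂μ) ^ (1 / (n : ℝ)) := by gcongr
    _ = _ := by
      rw [ENNReal.ofReal_mul (by positivity), ENNReal.mul_rpow_of_nonneg _ _ (by positivity),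
        ENNReal.ofReal_pow hc, ← ENNReal.rpow_natCast, ← ENNReal.rpow_mul,
        mul_one_div_cancel (by exact_mod_cast hn), ENNReal.rpow_one]

/-- A crude form of Young's inequality. -/
theorem mul_pow_mul_le_half_pow_add {n : ℕ} (hn : n ≠ 0) {a b : ℝ} (ha : 0 ≤ a) (hb : 0 ≤ b) :
    n * (a ^ (n - 1) * b) ≤ a ^ n / 2 + (2 * n) ^ n / 2 * b ^ n := by
  obtain ⟨m, rfl⟩ := Nat.exists_eq_succ_of_ne_zero hn
  rw [Nat.succ_sub_one]
  set N : ℝ := ((m.succ : ℕ) : ℝ) with hN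
  have hN0 : 0 ≤ N := Nat.cast_nonneg _
  rcases le_total (2 * N * b) a with h | h
  · have h1 : a ^ m * (2 * N * b) ≤ a ^ m * a := by gcongr
    have h2 : 0 ≤ (2 * N) ^ m.succ / 2 * b ^ m.succ := by positivity
    have h3 : a ^ m.succ = a ^ m * a := pow_succ a m
    linarith
  · have h1 : a ^ m * b ≤ (2 * N * b) ^ m * b := by gcongr
    have h2 : N * (a ^ m * b) ≤ N * ((2 * N * b) ^ m * b) := by gcongr
    have h3 : N * ((2 * N * b) ^ m * b) = (2 * N) ^ m.succ / 2 * b ^ m.succ := by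
      rw [pow_succ, pow_succ, mul_pow (2 * N) b m]; ring
    have h4 : 0 ≤ a ^ m.succ / 2 := by positivity
    linarith

/-- Caccioppoli inequality for truncations of weakly `n`-harmonic functions. -/
theorem eLpNorm_truncation_mul_fderiv_le {n : ℕ} (hn : 2 ≤ n) {Ω K : Set (E n)} (hΩ : IsOpen Ω)
    (hK : IsCompact K) (hKΩ : K ⊆ Ω) {u ξ : E n → ℝ} (hu : ContDiffOn ℝ 1 u Ω)
    (hweak : ∀ φ : E n → ℝ, ContDiff ℝ 1 φ → tsupport φ ⊆ Ω →
      (∫ y in Ω, ‖gradient u y‖ ^ ((n : ℝ) - 2) * ⟪gradient u y, gradient φ y⟫) = 0)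
    (hξ : ContDiff ℝ 1 ξ) (hξ0 : ∀ y, 0 ≤ ξ y) {ε : ℝ} {w p : ℝ → ℝ} (hw : IsTruncation ε w p)
    (hoff : ∀ y ∈ Ω, y ∉ K → y ∉ tsupport ξ ∨ u y ≤ ε) :
    eLpNorm (fun y => ξ y * p (u y) * ‖fderiv ℝ u y‖) n (volume.restrict Ω) ≤
      ENNReal.ofReal (2 * n) *
        eLpNorm (fun y => w (u y) * ‖fderiv ℝ ξ y‖) n (volume.restrict Ω) := by
  have hn0 : n ≠ 0 := by omega
  obtain ⟨G, hG, hGle⟩ := hw.exists_primitive hn0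
  have hξK : ∀ y, y ∉ tsupport ξ → ξ y = 0 ∧ fderiv ℝ ξ y = 0 := fun y hy =>
    ⟨image_eq_zero_of_notMem_tsupport hy,
      by_contra fun h => hy (support_fderiv_subset ℝ (Function.mem_support.2 h))⟩
  have huc := hu.continuousOn
  have hduc := hu.continuousOn_fderiv_of_isOpen hΩ le_rfl
  have hdξc := hξ.continuous_fderiv one_ne_zero
  have hgrad : ∀ y, ‖gradient u y‖ = ‖fderiv ℝ u y‖ := fun y => by simp [gradient]
  set A : E n → ℝ := fun y => ξ y * p (u y) * ‖fderiv ℝ u y‖ with hA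
  set B : E n → ℝ := fun y => w (u y) * ‖fderiv ℝ ξ y‖ with hB
  have hA0 : ∀ y, 0 ≤ A y := fun y =>
    mul_nonneg (mul_nonneg (hξ0 y) (hw.deriv_nonneg _)) (norm_nonneg _)
  have hB0 : ∀ y, 0 ≤ B y := fun y => mul_nonneg (hw.nonneg _) (norm_nonneg _)
  have hpu : ContinuousOn (fun y => p (u y)) Ω := hw.continuous_deriv.comp_continuousOn huc
  have hwu : ContinuousOn (fun y => w (u y)) Ω := hw.contDiff.continuous.comp_continuousOn huc
  have hAc : ContinuousOn A Ω := (hξ.continuous.continuousOn.mul hpu).mul hduc.norm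
  have hBc : ContinuousOn B Ω := hwu.mul hdξc.norm.continuousOn
  have hAi : IntegrableOn (fun y => A y ^ n) Ω :=
    integrableOn_of_continuousOn_of_eqOn_zero hΩ.measurableSet hK hKΩ (hAc.pow n)
      fun y hy hyK => by
        rcases hoff y hy hyK with h | h
        · simp [hA, (hξK y h).1, hn0]
        · simp [hA, hw.deriv_eq_zero _ h, hn0]
  have hBi : IntegrableOn (fun y => B y ^ n) Ω :=
    integrableOn_of_continuousOn_of_eqOn_zero hΩ.measurableSet hK hKΩ (hBc.pow n)
      fun y hy hyK => by
        rcases hoff y hy hyK with h | h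
        · simp [hB, (hξK y h).2, hn0]
        · simp [hB, hw.eq_zero _ h, hn0]
  set f : E n → ℝ := fun y => ξ y ^ n * G (u y) with hf
  have hf0 : ∀ y ∈ Ω, y ∉ K → f y = 0 := fun y hy hyK => by
    rcases hoff y hy hyK with h | h
    · simp [hf, (hξK y h).1, hn0]
    · simp [hf, hG.eq_zero _ h]
  have hfC : ContDiffOn ℝ 1 f Ω := (hξ.pow n).contDiffOn.mul (hG.contDiff.comp_contDiffOn hu)
  have hφ : ContDiff ℝ 1 (Ω.indicator f) :=
    contDiff_indicator_of_eqOn_zero hΩ hK.isClosed hKΩ hfC hf0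
  have hφK : tsupport (Ω.indicator f) ⊆ K := by
    refine closure_minimal (fun y hy => ?_) hK.isClosed
    by_contra hyK
    refine hy ?_
    by_cases hyΩ : y ∈ Ω
    · rw [indicator_of_mem hyΩ, hf0 y hyΩ hyK]
    · exact indicator_of_notMem hyΩ f
  have hzeroφ := hweak _ hφ (hφK.trans hKΩ)
  have hrpow : ∀ y, ‖gradient u y‖ ^ ((n : ℝ) - 2) = ‖fderiv ℝ u y‖ ^ (n - 2) := fun y => by
    rw [hgrad, ← Real.rpow_natCast, Nat.cast_sub hn]; norm_num
  have hinner : ∀ y (v : E n → ℝ), ⟪gradient u y, gradient v y⟫ = fderiv ℝ v y (gradient u y) :=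
    fun y v => by
      rw [real_inner_comm, gradient, InnerProductSpace.toDual_symm_apply]
  simp only [hrpow, hinner] at hzeroφ
  have hdφ : ∀ y ∈ Ω, fderiv ℝ (Ω.indicator f) y (gradient u y) =
      n * ξ y ^ (n - 1) * G (u y) * fderiv ℝ ξ y (gradient u y) +
        ξ y ^ n * p (u y) ^ n * ‖fderiv ℝ u y‖ ^ 2 := fun y hy => by
    have hmem := hΩ.mem_nhds hy
    have h1 : Ω.indicator f =ᶠ[𝓝 y] f := by
      filter_upwards [hmem] with z hz using indicator_of_mem hz f
    have h2 : HasFDerivAt u (fderiv ℝ u y) y :=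
      ((hu.contDiffAt hmem).differentiableAt (by norm_num)).hasFDerivAt
    have h3 : HasFDerivAt ξ (fderiv ℝ ξ y) y := (hξ.differentiable (by norm_num) y).hasFDerivAt
    have h4 := (h3.pow n).mul ((hG.hasDerivAt (u y)).comp_hasFDerivAt y h2)
    have h5 : fderiv ℝ u y (gradient u y) = ‖fderiv ℝ u y‖ ^ 2 := by
      rw [← hinner, real_inner_self_eq_norm_sq, hgrad]
    rw [h1.fderiv_eq]
    erw [h4.fderiv]
    simp [h5]
    ring
  have hFc : ContinuousOn
      (fun y => ‖fderiv ℝ u y‖ ^ (n - 2) * fderiv ℝ (Ω.indicator f) y (gradient u y)) Ω := by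
    refine (hduc.norm.pow _).mul ((hφ.continuous_fderiv one_ne_zero).continuousOn.clm_apply ?_)
    exact (InnerProductSpace.toDual ℝ (E n)).symm.continuous.comp_continuousOn hduc
  have hFi : IntegrableOn
      (fun y => ‖fderiv ℝ u y‖ ^ (n - 2) * fderiv ℝ (Ω.indicator f) y (gradient u y)) Ω :=
    integrableOn_of_continuousOn_of_eqOn_zero hΩ.measurableSet hK hKΩ hFc fun y _ hyK => by
      have : fderiv ℝ (Ω.indicator f) y = 0 := by_contra fun h =>
        hyK (hφK (support_fderiv_subset ℝ (Function.mem_support.2 h)))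
      simp [this]
  have hpt : ∀ y ∈ Ω, A y ^ n / 2 - (2 * n) ^ n / 2 * B y ^ n ≤
      ‖fderiv ℝ u y‖ ^ (n - 2) * fderiv ℝ (Ω.indicator f) y (gradient u y) := fun y hy => by
    rw [hdφ y hy]
    set D := ‖fderiv ℝ u y‖ with hD
    have hD0 : 0 ≤ D := norm_nonneg _
    have h1 : -(‖fderiv ℝ ξ y‖ * D) ≤ fderiv ℝ ξ y (gradient u y) := by
      have := (fderiv ℝ ξ y).le_opNorm (gradient u y)
      rw [hgrad] at this
      exact (abs_le.1 this).1
    have hc0 : 0 ≤ D ^ (n - 2) * (n * ξ y ^ (n - 1)) :=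
      mul_nonneg (pow_nonneg hD0 _) (mul_nonneg (Nat.cast_nonneg _) (pow_nonneg (hξ0 y) _))
    have h2 : -(p (u y) ^ (n - 1) * w (u y) * (‖fderiv ℝ ξ y‖ * D)) ≤
        G (u y) * fderiv ℝ ξ y (gradient u y) := by
      have h3 := mul_le_mul_of_nonneg_left h1 (hG.nonneg (u y))
      have h4 := mul_le_mul_of_nonneg_right (hGle (u y))
        (mul_nonneg (norm_nonneg (fderiv ℝ ξ y)) hD0)
      linarith
    have h5 := mul_le_mul_of_nonneg_left h2 hc0
    have h6 := mul_pow_mul_le_half_pow_add hn0 (hA0 y) (hB0 y)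
    obtain ⟨m, rfl⟩ : ∃ m, n = m + 2 := ⟨n - 2, by omega⟩
    simp only [show m + 2 - 2 = m by omega, show m + 2 - 1 = m + 1 by omega] at h5 h6 ⊢
    have h7 : D ^ m * (ξ y ^ (m + 2) * p (u y) ^ (m + 2) * D ^ 2) = A y ^ (m + 2) := by
      simp only [hA]; ring
    have h8 : D ^ m * (((m + 2 : ℕ) : ℝ) * ξ y ^ (m + 1)) *
        -(p (u y) ^ (m + 1) * w (u y) * (‖fderiv ℝ ξ y‖ * D)) =
        -(((m + 2 : ℕ) : ℝ) * (A y ^ (m + 1) * B y)) := by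
      simp only [hA, hB]; ring
    rw [h8] at h5
    linarith
  have hle := setIntegral_mono_on ((hAi.div_const 2).sub (hBi.const_mul ((2 * n) ^ n / 2))) hFi
    hΩ.measurableSet hpt
  rw [hzeroφ, integral_sub' (hAi.div_const 2) (hBi.const_mul _), integral_div,
    integral_const_mul] at hle
  refine eLpNorm_le_mul_eLpNorm_of_integral_pow_le hn0 (Eventually.of_forall hA0)
    (Eventually.of_forall hB0) hAi hBi (by positivity) ?_
  linarith

/-- Sobolev inequality from `Lⁿ` to `L²ⁿ` for functions supported in a fixed bounded subset of
`ℝⁿ`. -/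
theorem exists_eLpNorm_two_mul_le {n : ℕ} (hn : 2 ≤ n) {Ω : Set (E n)}
    (hb : Bornology.IsBounded Ω) :
    ∃ S : ℝ, 0 < S ∧ ∀ f : E n → ℝ, ContDiff ℝ 1 f → tsupport f ⊆ Ω →
      eLpNorm f ((2 * n : ℕ) : ℝ≥0∞) volume ≤
        ENNReal.ofReal S * eLpNorm (fun y => ‖fderiv ℝ f y‖) n (volume.restrict Ω) := by
  have hnR : (2 : ℝ) ≤ n := by exact_mod_cast hn
  have hnN : (2 : ℝ≥0) ≤ n := by exact_mod_cast hn
  set P : ℝ≥0 := 2 * n / 3 with hP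
  have hP1 : 1 ≤ P := by
    rw [hP, le_div_iff₀ (by norm_num)]; rw [← NNReal.coe_le_coe]; push_cast; linarith
  have hPn : P < n := by
    rw [hP, div_lt_iff₀ (by norm_num)]; rw [← NNReal.coe_lt_coe]; push_cast; linarith
  set S₀ : ℝ≥0 := eLpNormLESNormFDerivOfLeConst ℝ (volume : Measure (E n)) Ω P (2 * n : ℝ≥0)
  set V : ℝ≥0∞ := (volume Ω) ^ (1 / (P : ℝ≥0∞).toReal - 1 / (n : ℝ≥0∞).toReal) with hV
  have hVtop : V ≠ ∞ := by
    refine ENNReal.rpow_ne_top_of_nonneg ?_ hb.measure_lt_top.ne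
    rw [sub_nonneg, ENNReal.coe_toReal, ENNReal.toReal_natCast]
    exact one_div_le_one_div_of_le (by positivity) (by exact_mod_cast hPn.le)
  refine ⟨S₀ * V.toReal + 1, by positivity, fun f hf hfΩ => ?_⟩
  have h1 := eLpNorm_le_eLpNorm_fderiv_of_le (volume : Measure (E n)) (F := ℝ) hf
    ((subset_tsupport f).trans hfΩ) (p := P) (q := 2 * n) hP1 (by simpa using hPn) (by
      rw [finrank_euclideanSpace_fin, hP]; push_cast
      rw [inv_div, ← sub_nonneg]
      have : (0 : ℝ) < n := by linarith
      field_simp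
      norm_num) hb
  rw [← eLpNorm_norm (fderiv ℝ f)] at h1
  set g : E n → ℝ := fun y => ‖fderiv ℝ f y‖ with hg
  have hgs : Function.support g ⊆ Ω := fun y hy => hfΩ (support_fderiv_subset ℝ fun h => hy (by
    simp [hg, h]))
  have h3 := eLpNorm_le_eLpNorm_mul_rpow_measure_univ (μ := volume.restrict Ω)
    (f := g) (p := P) (q := n) (by exact_mod_cast hPn.le)
    (hf.continuous_fderiv one_ne_zero).norm.aestronglyMeasurable
  rw [Measure.restrict_apply_univ, eLpNorm_restrict_eq_of_support_subset hgs] at h3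
  calc eLpNorm f ((2 * n : ℕ) : ℝ≥0∞) volume
      ≤ S₀ * (eLpNorm g n (volume.restrict Ω) * V) := by
        refine (le_of_eq (by push_cast; rfl)).trans (h1.trans ?_)
        gcongr
    _ = (S₀ * V) * eLpNorm g n (volume.restrict Ω) := by ring
    _ ≤ _ := by
        gcongr
        rw [← ENNReal.ofReal_toReal (ENNReal.mul_ne_top ENNReal.coe_ne_top hVtop),
          ENNReal.toReal_mul]
        exact ENNReal.ofReal_le_ofReal (by simp)

/-- Reverse Hölder inequality for truncations of weakly `n`-harmonic functions that vanish on
`∂Ω ∩ B_R(x)`. -/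
theorem exists_reverse_holder {n : ℕ} (hn : 2 ≤ n) {Ω : Set (E n)} (hΩ : IsOpen Ω)
    (hb : Bornology.IsBounded Ω) :
    ∃ C : ℝ, 0 < C ∧ ∀ u : E n → ℝ, ContDiffOn ℝ 1 u Ω → ContinuousOn u (closure Ω) →
      (∀ φ : E n → ℝ, ContDiff ℝ 1 φ → tsupport φ ⊆ Ω →
        (∫ y in Ω, ‖gradient u y‖ ^ ((n : ℝ) - 2) * ⟪gradient u y, gradient φ y⟫) = 0) →
      ∀ (x : E n) (t T R : ℝ), 0 < t → t < T → T < R →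
        (∀ y ∈ ball x R ∩ frontier Ω, u y = 0) →
        ∀ (ε : ℝ) (w p : ℝ → ℝ), 0 < ε → IsTruncation ε w p →
          eLpNorm (fun y => w (u y)) ((2 * n : ℕ) : ℝ≥0∞) (volume.restrict (ball x t ∩ Ω)) ≤
            ENNReal.ofReal (C / (T - t)) *
              eLpNorm (fun y => w (u y)) n (volume.restrict (ball x T ∩ Ω)) := by
  obtain ⟨S, hS, hSob⟩ := exists_eLpNorm_two_mul_le hn hb
  obtain ⟨M, hM, hcut⟩ := exists_cutoff (E n)
  refine ⟨S * ((2 * n + 1) * M), by positivity,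
    fun u hu huc hweak x t T R ht htT hTR hzero ε w p hε hw => ?_⟩
  obtain ⟨ξ, hξ, hξ0, hξ1, hξt, hξT, hdξ⟩ := hcut x t T ht htT
  have hTt : 0 < T - t := sub_pos.2 htT
  set K : Set (E n) := closure Ω ∩ u ⁻¹' Ici ε ∩ closedBall x T with hKdef
  have hK : IsCompact K := by
    refine (isCompact_closedBall x T).inter_left ?_
    exact huc.preimage_isClosed_of_isClosed isClosed_closure isClosed_Ici
  have hKΩ : K ⊆ Ω := by
    rintro y ⟨⟨hy1, hy2⟩, hy3⟩
    by_contra hy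
    have hfr : y ∈ frontier Ω := ⟨hy1, by rwa [hΩ.interior_eq]⟩
    have h0 := hzero y ⟨closedBall_subset_ball hTR hy3, hfr⟩
    have : ε ≤ u y := hy2
    linarith
  have hξs : tsupport ξ ⊆ closedBall x T :=
    closure_minimal (fun y hy => by_contra fun h =>
      hy (hξT y fun h' => h (ball_subset_closedBall h'))) isClosed_closedBall
  have hoff : ∀ y ∈ Ω, y ∉ K → y ∉ tsupport ξ ∨ u y ≤ ε := fun y hy hyK => by
    by_contra! h
    exact hyK ⟨⟨subset_closure hy, h.2.le⟩, hξs h.1⟩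
  have hdξ0 : ∀ y ∉ ball x T, fderiv ℝ ξ y = 0 := fun y hy =>
    IsLocalMin.fderiv_eq_zero (Eventually.of_forall fun z => by rw [hξT y hy]; exact hξ0 z)
  set f : E n → ℝ := fun y => ξ y * w (u y) with hf
  have hf0 : ∀ y ∈ Ω, y ∉ K → f y = 0 := fun y hy hyK => by
    rcases hoff y hy hyK with h | h
    · simp [hf, image_eq_zero_of_notMem_tsupport h]
    · simp [hf, hw.eq_zero _ h]
  have hF : ContDiff ℝ 1 (Ω.indicator f) :=
    contDiff_indicator_of_eqOn_zero hΩ hK.isClosed hKΩ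
      (hξ.contDiffOn.mul (hw.contDiff.comp_contDiffOn hu)) hf0
  have hFK : tsupport (Ω.indicator f) ⊆ K := by
    refine closure_minimal (fun y hy => ?_) hK.isClosed
    by_contra hyK
    refine hy ?_
    by_cases hyΩ : y ∈ Ω
    · rw [indicator_of_mem hyΩ, hf0 y hyΩ hyK]
    · exact indicator_of_notMem hyΩ f
  have huΩ := hu.continuousOn
  have hduc := hu.continuousOn_fderiv_of_isOpen hΩ le_rfl
  set A : E n → ℝ := fun y => ξ y * p (u y) * ‖fderiv ℝ u y‖ with hA
  set B : E n → ℝ := fun y => w (u y) * ‖fderiv ℝ ξ y‖ with hB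
  have hAc : ContinuousOn A Ω :=
    (hξ.continuous.continuousOn.mul (hw.continuous_deriv.comp_continuousOn huΩ)).mul hduc.norm
  have hBc : ContinuousOn B Ω := (hw.contDiff.continuous.comp_continuousOn huΩ).mul
    (hξ.continuous_fderiv one_ne_zero).norm.continuousOn
  have hcacc : eLpNorm A n (volume.restrict Ω) ≤
      ENNReal.ofReal (2 * n) * eLpNorm B n (volume.restrict Ω) :=
    eLpNorm_truncation_mul_fderiv_le hn hΩ hK hKΩ hu hweak hξ hξ0 hw hoff
  have hd : ∀ y ∈ Ω, ‖‖fderiv ℝ (Ω.indicator f) y‖‖ ≤ (A + B) y := fun y hy => by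
    have hmem := hΩ.mem_nhds hy
    have h1 : Ω.indicator f =ᶠ[𝓝 y] f := by
      filter_upwards [hmem] with z hz using indicator_of_mem hz f
    have h2 : HasFDerivAt u (fderiv ℝ u y) y :=
      ((hu.contDiffAt hmem).differentiableAt (by norm_num)).hasFDerivAt
    have h3 : HasFDerivAt ξ (fderiv ℝ ξ y) y := (hξ.differentiable (by norm_num) y).hasFDerivAt
    have h4 : HasFDerivAt f (ξ y • p (u y) • fderiv ℝ u y + w (u y) • fderiv ℝ ξ y) y :=
      h3.mul ((hw.hasDerivAt (u y)).comp_hasFDerivAt y h2)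
    rw [norm_norm, h1.fderiv_eq, h4.fderiv]
    refine (norm_add_le _ _).trans (le_of_eq ?_)
    rw [norm_smul, norm_smul, norm_smul, Real.norm_of_nonneg (hξ0 y),
      Real.norm_of_nonneg (hw.deriv_nonneg _), Real.norm_of_nonneg (hw.nonneg _), Pi.add_apply, hA,
      hB]
    ring
  have hBle : eLpNorm B n (volume.restrict Ω) ≤ ENNReal.ofReal (M / (T - t)) *
      eLpNorm (fun y => w (u y)) n (volume.restrict (ball x T ∩ Ω)) := by
    have hBs : Function.support B ⊆ ball x T := fun y hy => by_contra fun h =>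
      hy (by simp [hB, hdξ0 y h])
    rw [← eLpNorm_restrict_eq_of_support_subset hBs, Measure.restrict_restrict measurableSet_ball]
    refine eLpNorm_le_mul_eLpNorm_of_ae_le_mul (Eventually.of_forall fun y => ?_) _
    rw [hB]
    beta_reduce
    rw [norm_mul, norm_norm, mul_comm]
    gcongr
    exact hdξ y
  calc eLpNorm (fun y => w (u y)) ((2 * n : ℕ) : ℝ≥0∞) (volume.restrict (ball x t ∩ Ω))
      = eLpNorm (Ω.indicator f) ((2 * n : ℕ) : ℝ≥0∞) (volume.restrict (ball x t ∩ Ω)) := by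
        refine eLpNorm_congr_ae (ae_restrict_of_forall_mem
          (measurableSet_ball.inter hΩ.measurableSet) fun y hy => ?_)
        simp [indicator_of_mem hy.2, hf, hξt y hy.1]
    _ ≤ eLpNorm (Ω.indicator f) ((2 * n : ℕ) : ℝ≥0∞) volume := eLpNorm_restrict_le _ _ _ _
    _ ≤ ENNReal.ofReal S *
        eLpNorm (fun y => ‖fderiv ℝ (Ω.indicator f) y‖) n (volume.restrict Ω) :=
      hSob _ hF (hFK.trans hKΩ)
    _ ≤ ENNReal.ofReal S * eLpNorm (A + B) n (volume.restrict Ω) := by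
      gcongr
      exact eLpNorm_mono_ae_real (ae_restrict_of_forall_mem hΩ.measurableSet hd)
    _ ≤ ENNReal.ofReal S *
        (eLpNorm A n (volume.restrict Ω) + eLpNorm B n (volume.restrict Ω)) := by
      gcongr
      exact eLpNorm_add_le (hAc.aestronglyMeasurable hΩ.measurableSet)
        (hBc.aestronglyMeasurable hΩ.measurableSet) (by exact_mod_cast (by omega : 1 ≤ n))
    _ ≤ ENNReal.ofReal S * (ENNReal.ofReal (2 * n) * eLpNorm B n (volume.restrict Ω) +
        eLpNorm B n (volume.restrict Ω)) := by gcongr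
    _ = ENNReal.ofReal S * ENNReal.ofReal (2 * n + 1) * eLpNorm B n (volume.restrict Ω) := by
      rw [ENNReal.ofReal_add (by positivity) zero_le_one, ENNReal.ofReal_one]; ring
    _ ≤ ENNReal.ofReal S * ENNReal.ofReal (2 * n + 1) * (ENNReal.ofReal (M / (T - t)) *
        eLpNorm (fun y => w (u y)) n (volume.restrict (ball x T ∩ Ω))) := by gcongr
    _ = _ := by
      rw [← mul_assoc, ← ENNReal.ofReal_mul hS.le, ← ENNReal.ofReal_mul (by positivity)]
      congr 2
      ring

/-- The recursion of Moser's iteration, solved in closed form. -/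
theorem mul_four_pow_mul_le_of_succ_le {D : ℝ≥0∞} {Y : ℕ → ℝ≥0∞}
    (h : ∀ j, Y (j + 1) ≤ (D * 2 ^ j * Y j) ^ 2) (j : ℕ) :
    D ^ 2 * 4 * 4 ^ j * Y j ≤ (4 * D ^ 2 * Y 0) ^ 2 ^ j := by
  induction j with
  | zero => exact le_of_eq (by ring)
  | succ j ih =>
    calc D ^ 2 * 4 * 4 ^ (j + 1) * Y (j + 1)
        ≤ D ^ 2 * 4 * 4 ^ (j + 1) * (D * 2 ^ j * Y j) ^ 2 := by gcongr; exact h j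
      _ = (D ^ 2 * 4 * 4 ^ j * Y j) ^ 2 := by
        have : (4 : ℝ≥0∞) ^ j = (2 ^ j) ^ 2 := by rw [← pow_mul, mul_comm, pow_mul]; norm_num
        rw [pow_succ (4 : ℝ≥0∞) j, this]; ring
      _ ≤ ((4 * D ^ 2 * Y 0) ^ 2 ^ j) ^ 2 := by gcongr
      _ = _ := by rw [← pow_mul, ← pow_succ]

/-- Control of the `Lⁿ` norms of the powers `H^(2^j)` with a gain `4^j` bounds `H` pointwise. -/
theorem ae_lt_of_eLpNorm_pow_le {α : Type*} [MeasurableSpace α] {μ : Measure α} {n : ℕ}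
    (hn : n ≠ 0) {H : α → ℝ} (hH0 : ∀ y, 0 ≤ H y) (hHm : AEStronglyMeasurable H μ) {M : ℝ}
    (hM : 0 < M) {c : ℝ≥0∞} (hc : c ≠ 0)
    (h : ∀ j : ℕ, c * 4 ^ j * eLpNorm (fun y => H y ^ 2 ^ j) n μ ≤ ENNReal.ofReal M ^ 2 ^ j) :
    ∀ᵐ y ∂μ, H y < M := by
  set S : Set α := {y | M ≤ H y} with hS
  set a : ℝ≥0∞ := μ S ^ (1 / (n : ℝ)) with ha
  have hnR : (0 : ℝ) < n := by exact_mod_cast Nat.pos_of_ne_zero hn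
  have hle : ∀ j : ℕ, c * 4 ^ j * a ≤ 1 := fun j => by
    set δ := ENNReal.ofReal M ^ 2 ^ j with hδ
    have hδ0 : δ ≠ 0 := pow_ne_zero _ (by simpa using hM)
    have hδt : δ ≠ ∞ := ENNReal.pow_ne_top ENNReal.ofReal_ne_top
    have hset : S ⊆ {y | δ ≤ ‖H y ^ 2 ^ j‖ₑ} := fun y hy => by
      have hy' : M ≤ H y := hy
      rw [mem_ofPred_eq, Real.enorm_eq_ofReal (pow_nonneg (hH0 y) _), ENNReal.ofReal_pow (hH0 y)]
      exact pow_le_pow_left' (ENNReal.ofReal_le_ofReal hy') _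
    have h1 : δ * a ≤ eLpNorm (fun y => H y ^ 2 ^ j) n μ := by
      have h2 := mul_meas_ge_le_pow_eLpNorm' μ (p := n) (by exact_mod_cast hn) (by simp)
        (hHm.pow (2 ^ j)) δ
      rw [ENNReal.toReal_natCast] at h2
      have h3 : (δ * a) ^ (n : ℝ) ≤ eLpNorm (fun y => H y ^ 2 ^ j) n μ ^ (n : ℝ) := by
        refine le_trans ?_ h2
        rw [ENNReal.mul_rpow_of_nonneg _ _ hnR.le, ha, ← ENNReal.rpow_mul,
          one_div_mul_cancel hnR.ne', ENNReal.rpow_one]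
        gcongr
        exact hset
      exact (ENNReal.rpow_le_rpow_iff hnR).1 h3
    have h4 : δ * (c * 4 ^ j * a) ≤ δ * 1 := by
      calc δ * (c * 4 ^ j * a) = c * 4 ^ j * (δ * a) := by ring
        _ ≤ c * 4 ^ j * eLpNorm (fun y => H y ^ 2 ^ j) n μ := by gcongr
        _ ≤ δ * 1 := by rw [mul_one]; exact h j
    exact (ENNReal.mul_le_mul_iff_right hδ0 hδt).1 h4
  have ha0 : a = 0 := by
    by_contra ha0
    obtain ⟨j, hj⟩ := ENNReal.exists_nat_mul_gt (mul_ne_zero hc ha0) ENNReal.one_ne_top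
    refine (hj.trans_le ?_).not_ge (hle j)
    rw [mul_right_comm, mul_comm _ ((4 : ℝ≥0∞) ^ j)]
    gcongr
    exact_mod_cast (Nat.lt_pow_self (by norm_num : 1 < 4)).le
  have hS0 : μ S = 0 := by
    rw [ha, ENNReal.rpow_eq_zero_iff] at ha0
    rcases ha0 with h | h
    · exact h.1
    · have : 0 < 1 / (n : ℝ) := by positivity
      linarith [h.2]
  rw [ae_iff]
  simpa [hS, not_lt] using hS0

theorem eLpNorm_sq_eq {α : Type*} [MeasurableSpace α] {μ : Measure α} {n : ℕ} (f : α → ℝ) :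
    eLpNorm (fun y => f y ^ 2) n μ = eLpNorm f ((2 * n : ℕ) : ℝ≥0∞) μ ^ 2 := by
  have h := eLpNorm_norm_rpow (p := (n : ℝ≥0∞)) (μ := μ) f (q := 2) (by norm_num)
  have h1 : (fun y => f y ^ 2) = fun y => ‖f y‖ ^ (2 : ℝ) := by
    funext y
    rw [Real.rpow_two, Real.norm_eq_abs, sq_abs]
  have h2 : (n : ℝ≥0∞) * ENNReal.ofReal 2 = ((2 * n : ℕ) : ℝ≥0∞) := by
    rw [ENNReal.ofReal_ofNat]; push_cast; ring
  rw [h1, h, h2, ← ENNReal.rpow_two]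

/-- The estimate for truncations: any bound on the `Lⁿ` norm over the larger ball
gives a pointwise bound on the smaller one. -/
theorem exists_ae_lt_of_isTruncation {n : ℕ} (hn : 2 ≤ n) {Ω : Set (E n)} (hΩ : IsOpen Ω)
    (hb : Bornology.IsBounded Ω) :
    ∃ C : ℝ, 0 < C ∧ ∀ u : E n → ℝ, ContDiffOn ℝ 1 u Ω → ContinuousOn u (closure Ω) →
      (∀ φ : E n → ℝ, ContDiff ℝ 1 φ → tsupport φ ⊆ Ω →
        (∫ y in Ω, ‖gradient u y‖ ^ ((n : ℝ) - 2) * ⟪gradient u y, gradient φ y⟫) = 0) →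
      ∀ (x : E n) (r R : ℝ), 0 < r → r < R → (∀ y ∈ ball x R ∩ frontier Ω, u y = 0) →
        ∀ (ε : ℝ) (w p : ℝ → ℝ), 0 < ε → IsTruncation ε w p → ∀ b : ℝ, 0 < b →
          eLpNorm (fun y => w (u y)) n (volume.restrict (ball x R ∩ Ω)) ≤ ENNReal.ofReal b →
          ∀ᵐ y ∂(volume.restrict (ball x r ∩ Ω)), w (u y) < C / (R - r) ^ 2 * b := by
  obtain ⟨C, hC, hRH⟩ := exists_reverse_holder hn hΩ hb
  refine ⟨64 * C ^ 2, by positivity,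
    fun u hu huc hweak x r R hr hrR hzero ε w p hε hw b hb0 hbound => ?_⟩
  have hRr : 0 < R - r := sub_pos.2 hrR
  set t : ℕ → ℝ := fun j => r + (R - r) / 2 ^ (j + 1) with ht
  have htr : ∀ j, r < t j := fun j => by
    have : 0 < (R - r) / 2 ^ (j + 1) := by positivity
    simp only [ht]; linarith
  have htsub : ∀ j, t j - t (j + 1) = (R - r) / (4 * 2 ^ j) := fun j => by
    simp only [ht]; rw [pow_succ, pow_succ, pow_succ]; field_simp; ring
  have htR : ∀ j, t j < R := fun j => by
    have h1 : (1 : ℝ) < 2 ^ (j + 1) := one_lt_pow₀ one_lt_two (by omega)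
    have : (R - r) / 2 ^ (j + 1) < R - r := div_lt_self hRr h1
    simp only [ht]; linarith
  set Y : ℕ → ℝ≥0∞ := fun j =>
    eLpNorm (fun y => w (u y) ^ 2 ^ j) n (volume.restrict (ball x (t j) ∩ Ω)) with hY
  set D : ℝ := 4 * C / (R - r) with hD
  have hD0 : 0 < D := by positivity
  have hstep : ∀ j, Y (j + 1) ≤ (ENNReal.ofReal D * 2 ^ j * Y j) ^ 2 := fun j => by
    have hlt : t (j + 1) < t j := by
      have : 0 < (R - r) / (4 * 2 ^ j) := by positivity
      linarith [htsub j]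
    have h := hRH u hu huc hweak x (t (j + 1)) (t j) R (hr.trans (htr _)) hlt (htR j) hzero ε _ _
      hε (hw.pow (a := 2 ^ j) (by positivity))
    have hconst : ENNReal.ofReal (C / (t j - t (j + 1))) = ENNReal.ofReal D * 2 ^ j := by
      rw [htsub, show C / ((R - r) / (4 * 2 ^ j)) = D * 2 ^ j by rw [hD]; field_simp,
        ENNReal.ofReal_mul hD0.le, ENNReal.ofReal_pow zero_le_two, ENNReal.ofReal_ofNat]
    rw [hconst] at h
    have hsq : Y (j + 1) = eLpNorm (fun y => w (u y) ^ 2 ^ j) ((2 * n : ℕ) : ℝ≥0∞)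
        (volume.restrict (ball x (t (j + 1)) ∩ Ω)) ^ 2 := by
      rw [← eLpNorm_sq_eq]
      simp only [hY, ← pow_mul, ← pow_succ]
    rw [hsq]
    gcongr
  have hY0 : Y 0 ≤ ENNReal.ofReal b := by
    refine le_trans ?_ hbound
    simp only [hY, pow_zero, pow_one]
    exact eLpNorm_mono_measure _ (Measure.restrict_mono
      (inter_subset_inter_left _ (ball_subset_ball (htR 0).le)) le_rfl)
  have hM : 64 * C ^ 2 / (R - r) ^ 2 * b = 4 * D ^ 2 * b := by
    rw [hD, div_pow]; ring
  rw [hM]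
  have hmeas : AEStronglyMeasurable (fun y => w (u y)) (volume.restrict (ball x r ∩ Ω)) :=
    (hw.contDiff.continuous.comp_continuousOn
      (hu.continuousOn.mono inter_subset_right)).aestronglyMeasurable
      (measurableSet_ball.inter hΩ.measurableSet)
  refine ae_lt_of_eLpNorm_pow_le (n := n) (by omega) (fun y => hw.nonneg _) hmeas (by positivity)
    (c := ENNReal.ofReal D ^ 2 * 4) (mul_ne_zero (pow_ne_zero _ (by simpa using hD0)) (by simp))
    fun j => ?_
  calc ENNReal.ofReal D ^ 2 * 4 * 4 ^ j *
        eLpNorm (fun y => w (u y) ^ 2 ^ j) n (volume.restrict (ball x r ∩ Ω))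
      ≤ ENNReal.ofReal D ^ 2 * 4 * 4 ^ j * Y j := by
        gcongr
        exact eLpNorm_mono_measure _ (Measure.restrict_mono
          (inter_subset_inter_left _ (ball_subset_ball (htr j).le)) le_rfl)
    _ ≤ (4 * ENNReal.ofReal D ^ 2 * Y 0) ^ 2 ^ j := mul_four_pow_mul_le_of_succ_le hstep j
    _ ≤ (4 * ENNReal.ofReal D ^ 2 * ENNReal.ofReal b) ^ 2 ^ j := by gcongr
    _ = _ := by
      rw [ENNReal.ofReal_mul (by positivity), ENNReal.ofReal_mul (by norm_num),
        ENNReal.ofReal_pow hD0.le, ENNReal.ofReal_ofNat]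

/-- Moser iteration boundary estimate: on a bounded open Ω there are C = C(Ω,n) > 0,
q = q(Ω,n) > 1 such that every n-harmonic u vanishing on a connected component Γ of ∂Ω
satisfies ‖u₊‖_{L^∞(B_r(x)∩Ω)} ≤ C (R−r)^{-q} ‖u₊‖_{L^n(B_R(x)∩Ω)} for x ∈ Γ, 0 < r < R
with B_R(x) ∩ ∂Ω ⊆ Γ. -/
theorem stmt18 (n : ℕ) (hn : 2 ≤ n)
    (Ω : Set (E n)) (hΩ : IsOpen Ω) (hb : Bornology.IsBounded Ω) :
    ∃ C : ℝ, 0 < C ∧ ∃ q : ℝ, 1 < q ∧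
      ∀ Γ : Set (E n), (∃ z ∈ frontier Ω, Γ = connectedComponentIn (frontier Ω) z) →
        ∀ u : E n → ℝ, ContDiffOn ℝ 1 u Ω → ContinuousOn u (closure Ω) →
          (∀ φ : E n → ℝ, ContDiff ℝ 1 φ → tsupport φ ⊆ Ω →
            (∫ y in Ω, ‖gradient u y‖ ^ ((n : ℝ) - 2) * ⟪gradient u y, gradient φ y⟫) = 0) →
          (∀ y ∈ Γ, u y = 0) →
          ∀ x ∈ Γ, ∀ r R : ℝ, 0 < r → r < R → ball x R ∩ frontier Ω ⊆ Γ →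
            eLpNorm (fun y => max (u y) 0) ⊤ (volume.restrict (ball x r ∩ Ω)) ≤
              ENNReal.ofReal (C / (R - r) ^ q) *
                eLpNorm (fun y => max (u y) 0) (n : ℝ≥0∞) (volume.restrict (ball x R ∩ Ω)) := by
  obtain ⟨C, hC, hest⟩ := exists_ae_lt_of_isTruncation hn hΩ hb
  refine ⟨C, hC, 2, one_lt_two, fun Γ _ u hu huc hweak hΓ x _ r R hr hrR hball => ?_⟩
  have hzero : ∀ y ∈ ball x R ∩ frontier Ω, u y = 0 := fun y hy => hΓ y (hball hy)
  have hRr : 0 < R - r := sub_pos.2 hrR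
  rw [Real.rpow_two]
  set k : ℝ := C / (R - r) ^ 2 with hk
  have hk0 : 0 < k := by positivity
  set N := eLpNorm (fun y => max (u y) 0) (n : ℝ≥0∞) (volume.restrict (ball x R ∩ Ω)) with hN
  by_cases hNt : N = ∞
  · rw [hNt, ENNReal.mul_top (by simpa using hk0)]
    exact le_top
  have hbd : ∀ b : ℝ, 0 < b → N ≤ ENNReal.ofReal b →
      eLpNorm (fun y => max (u y) 0) ⊤ (volume.restrict (ball x r ∩ Ω)) ≤
        ENNReal.ofReal (k * b) := fun b hb0 hNb => by
    have hj : ∀ j : ℕ, ∀ᵐ y ∂(volume.restrict (ball x r ∩ Ω)),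
        u y ≤ k * b + 2 * (1 / ((j : ℝ) + 1)) := fun j => by
      have hε : 0 < 1 / ((j : ℝ) + 1) := Nat.one_div_pos_of_nat
      obtain ⟨w, p, hw, hle, hge⟩ := exists_isTruncation hε
      filter_upwards [hest u hu huc hweak x r R hr hrR hzero _ w p hε hw b hb0 (le_trans
        (eLpNorm_mono_real fun y => by
          rw [Real.norm_of_nonneg (hw.nonneg _)]; exact hle _) hNb)] with y hy
      linarith [hge (u y)]
    rw [eLpNorm_exponent_top]
    refine eLpNormEssSup_le_of_ae_bound ?_
    filter_upwards [ae_all_iff.2 hj] with y hy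
    rw [Real.norm_of_nonneg (le_max_right _ _)]
    refine max_le ?_ (by positivity)
    have hlim : Tendsto (fun j : ℕ => k * b + 2 * (1 / ((j : ℝ) + 1))) atTop
        (𝓝 (k * b + 2 * 0)) :=
      (tendsto_one_div_add_atTop_nhds_zero_nat.const_mul 2).const_add _
    rw [mul_zero, add_zero] at hlim
    exact ge_of_tendsto' hlim hy
  refine ENNReal.le_of_forall_pos_le_add fun δ hδ _ => ?_
  have hδ' : (0 : ℝ) < δ := hδ
  have h := hbd (N.toReal + δ / k) (by positivity) (by
    rw [ENNReal.ofReal_add (by positivity) (by positivity), ENNReal.ofReal_toReal hNt]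
    exact le_self_add)
  refine h.trans (le_of_eq ?_)
  rw [mul_add, mul_div_cancel₀ _ hk0.ne', ENNReal.ofReal_add (by positivity) hδ'.le,
    ENNReal.ofReal_mul hk0.le, ENNReal.ofReal_toReal hNt, ENNReal.ofReal_coe_nnreal]
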